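/- Lemma 2.1 (Sobolev bounds for the coefficients of the coordinate change). Let σ ≥ 2 be an integer. There exist δ₀ > 0 and C > 0 such that the following holds. Let V : ℝ → ℝ be smooth with ‖V' − 1‖_{H^σ(ℝ)} + ‖V''‖_{H^σ(ℝ)} ≤ δ for some δ ≤ δ₀ (so that V is a smooth diffeomorphism of ℝ onto ℝ), and define a, b : ℝ → ℝ by a = V' ∘ V^{−1} and b = V'' ∘ V^{−1}. Then ‖a − 1‖_{H^σ(ℝ)} + ‖b‖_{H^σ(ℝ)} ≤ C(‖V' − 1‖_{H^σ(ℝ)} + ‖V''‖_{H^σ(ℝ)}) ≤ Cδ, and moreover ‖∂_Y(a² − 1)‖_{H^σ(ℝ)} = 2‖b‖_{H^σ(ℝ)} ≤ C‖V''‖_{H^σ(ℝ)}. -/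

import Mathlib

open MeasureTheory
open scoped ENNReal

noncomputable section

/-- Squared `L²(ℝ)` norm, valued in `[0,∞]`. -/
def L2Rsq (g : ℝ → ℝ) : ℝ≥0∞ := ∫⁻ Y : ℝ, (‖g Y‖₊ : ℝ≥0∞) ^ 2

/-- Squared `H^σ(ℝ)` norm: `Σ_{j≤σ} ‖g^{(j)}‖²_{L²}`, valued in `[0,∞]`. -/
def HRsq (σ : ℕ) (g : ℝ → ℝ) : ℝ≥0∞ :=
  ∑ j ∈ Finset.range (σ + 1), L2Rsq (deriv^[j] g)

/-- `H^σ(ℝ)` norm, valued in `[0,∞]`. -/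
def HR (σ : ℕ) (g : ℝ → ℝ) : ℝ≥0∞ := HRsq σ g ^ ((1 : ℝ) / 2)

/-- Uniform bounds on the derivatives of a product. -/
lemma abs_iteratedDeriv_mul_le {f g : ℝ → ℝ} {n : ℕ} {K L : ℝ}
    (hf : ContDiff ℝ (⊤ : ℕ∞) f) (hg : ContDiff ℝ (⊤ : ℕ∞) g)
    (hfK : ∀ i ≤ n, ∀ x, |iteratedDeriv i f x| ≤ K)
    (hgL : ∀ i ≤ n, ∀ x, |iteratedDeriv i g x| ≤ L) :
    ∀ i ≤ n, ∀ x, |iteratedDeriv i (fun y => f y * g y) x| ≤ 2 ^ n * (K * L) := by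
  intro i hi x
  have hK : 0 ≤ K := (abs_nonneg _).trans (hfK 0 (Nat.zero_le n) 0)
  have hL : 0 ≤ L := (abs_nonneg _).trans (hgL 0 (Nat.zero_le n) 0)
  have h := norm_iteratedFDeriv_mul_le (n := i) hf hg x (by exact_mod_cast le_top)
  simp only [norm_iteratedFDeriv_eq_norm_iteratedDeriv, Real.norm_eq_abs] at h
  calc _ ≤ _ := h
    _ ≤ ∑ j ∈ Finset.range (i + 1), (i.choose j : ℝ) * (K * L) := by
        refine Finset.sum_le_sum fun j hj => ?_
        have hj : j ≤ i := Nat.lt_succ_iff.mp (Finset.mem_range.mp hj)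
        rw [mul_assoc]
        gcongr
        · exact hfK j (hj.trans hi) x
        · exact hgL (i - j) ((Nat.sub_le i j).trans hi) x
    _ = 2 ^ i * (K * L) := by
        rw [← Finset.sum_mul]
        congr 1
        exact_mod_cast Nat.sum_range_choose i
    _ ≤ 2 ^ n * (K * L) := by
        gcongr
        norm_num

/-- Faà di Bruno bound: derivatives of a composition, the inner function having derivatives
bounded by a constant. -/
lemma abs_iteratedDeriv_comp_le {F W : ℝ → ℝ} {n : ℕ} {C D : ℝ} (hD : 1 ≤ D)
    (hF : ContDiff ℝ (⊤ : ℕ∞) F) (hW : ContDiff ℝ (⊤ : ℕ∞) W)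
    (hWD : ∀ i < n, ∀ Y, |iteratedDeriv i (deriv W) Y| ≤ D) (Y : ℝ)
    (hFC : ∀ i ≤ n, |iteratedDeriv i F (W Y)| ≤ C) :
    |iteratedDeriv n (fun Z => F (W Z)) Y| ≤ n.factorial * C * D ^ n := by
  have h := norm_iteratedFDeriv_comp_le (n := n) (C := C) (D := D) hF hW
    (by exact_mod_cast le_top) Y
  simp only [norm_iteratedFDeriv_eq_norm_iteratedDeriv, Real.norm_eq_abs] at h
  refine h hFC fun i h1 hi => ?_
  obtain ⟨k, rfl⟩ := Nat.exists_eq_succ_of_ne_zero (Nat.one_le_iff_ne_zero.mp h1)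
  rw [iteratedDeriv_succ']
  exact (hWD k hi Y).trans (le_self_pow₀ hD (Nat.succ_ne_zero k))

lemma contDiff_deriv {f : ℝ → ℝ} (hf : ContDiff ℝ (⊤ : ℕ∞) f) :
    ContDiff ℝ (⊤ : ℕ∞) (deriv f) :=
  (contDiff_infty_iff_deriv.mp hf).2

lemma hasDerivAt_deriv {f : ℝ → ℝ} (hf : ContDiff ℝ (⊤ : ℕ∞) f) (x : ℝ) :
    HasDerivAt f (deriv f x) x :=
  (hf.differentiable (by simp) x).hasDerivAt

lemma deriv_mul_deriv_rightInverse {V W : ℝ → ℝ} (hV : ContDiff ℝ (⊤ : ℕ∞) V)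
    (hW : ContDiff ℝ (⊤ : ℕ∞) W) (hVW : ∀ Y, V (W Y) = Y) (Y : ℝ) :
    deriv V (W Y) * deriv W Y = 1 := by
  have h := (hasDerivAt_deriv hV (W Y)).comp Y (hasDerivAt_deriv hW Y)
  have h' : V ∘ W = id := funext hVW
  rw [h'] at h
  exact h.unique (hasDerivAt_id Y)

/-- The second derivative of an inverse function. -/
lemma deriv_deriv_rightInverse {V W : ℝ → ℝ} (hV : ContDiff ℝ (⊤ : ℕ∞) V)
    (hW : ContDiff ℝ (⊤ : ℕ∞) W) (hVW : ∀ Y, V (W Y) = Y) :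
    deriv (deriv W) = fun Y =>
      -(deriv (deriv V) (W Y) * (deriv W Y * (deriv W Y * deriv W Y))) := by
  funext Y
  have h1 := deriv_mul_deriv_rightInverse hV hW hVW
  have h := ((hasDerivAt_deriv (contDiff_deriv hV) (W Y)).comp Y (hasDerivAt_deriv hW Y)).mul
    (hasDerivAt_deriv (contDiff_deriv hW) Y)
  have h' : (deriv V ∘ W) * deriv W = fun _ => (1 : ℝ) := funext h1
  rw [h'] at h
  have h0 := h.unique (hasDerivAt_const Y (1 : ℝ))
  simp only [Function.comp_apply] at h0
  linear_combination deriv W Y * h0 - deriv (deriv W) Y * h1 Y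

/-- Derivatives of an inverse function are bounded in terms of those of the function. -/
lemma exists_bound_iteratedDeriv_rightInverse (n : ℕ) (M : ℝ) :
    ∃ D : ℝ, 1 ≤ D ∧ ∀ V W : ℝ → ℝ, ContDiff ℝ (⊤ : ℕ∞) V → ContDiff ℝ (⊤ : ℕ∞) W →
      (∀ Y, V (W Y) = Y) → (∀ y, 1 / 2 ≤ deriv V y) →
      (∀ i < n, ∀ y, |iteratedDeriv i (deriv (deriv V)) y| ≤ M) →
      ∀ i ≤ n, ∀ Y, |iteratedDeriv i (deriv W) Y| ≤ D := by
  induction n with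
  | zero =>
    refine ⟨2, by norm_num, fun V W hV hW hVW hV' _ i hi Y => ?_⟩
    obtain rfl := Nat.le_zero.mp hi
    have h1 := deriv_mul_deriv_rightInverse hV hW hVW Y
    have h2 := hV' (W Y)
    rw [iteratedDeriv_zero, abs_le]
    have hpos : 0 < deriv W Y := by
      by_contra! h
      nlinarith
    constructor <;> nlinarith
  | succ n ih =>
    obtain ⟨D, hD, H⟩ := ih
    refine ⟨max D (2 ^ n * ((n.factorial * max M 0 * D ^ n) *
      (2 ^ n * (D * (2 ^ n * (D * D)))))), le_max_of_le_left hD,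
      fun V W hV hW hVW hV' hM => ?_⟩
    have hWD := H V W hV hW hVW hV' fun i hi => hM i (hi.trans n.lt_succ_self)
    intro i hi Y
    rcases Nat.le_succ_iff.mp hi with hi | rfl
    · exact (hWD i hi Y).trans (le_max_left _ _)
    refine le_trans ?_ (le_max_right _ _)
    have hW' := contDiff_deriv hW
    have hV'' := contDiff_deriv (contDiff_deriv hV)
    rw [iteratedDeriv_succ', deriv_deriv_rightInverse hV hW hVW, iteratedDeriv_fun_neg, abs_neg]
    refine abs_iteratedDeriv_mul_le (hV''.comp hW) (hW'.mul (hW'.mul hW')) ?_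
      (abs_iteratedDeriv_mul_le hW' (hW'.mul hW') hWD
        (abs_iteratedDeriv_mul_le hW' hW' hWD hWD)) n le_rfl Y
    intro j hj Z
    refine (abs_iteratedDeriv_comp_le hD hV'' hW (fun k hk => hWD k (hk.le.trans hj)) Z
      fun k hk => (hM k (by omega) _).trans (le_max_left M 0)).trans ?_
    gcongr

lemma L2Rsq_eq_lintegral_ofReal (g : ℝ → ℝ) :
    L2Rsq g = ∫⁻ Y : ℝ, ENNReal.ofReal (g Y ^ 2) := by
  refine lintegral_congr fun Y => ?_
  rw [← sq_abs, ENNReal.ofReal_pow (abs_nonneg _), ← Real.norm_eq_abs, ofReal_norm, enorm_eq_nnnorm]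

lemma L2Rsq_deriv_le_HRsq {σ j : ℕ} (hj : j ≤ σ) (g : ℝ → ℝ) :
    L2Rsq (deriv^[j] g) ≤ HRsq σ g :=
  Finset.single_le_sum (f := fun j => L2Rsq (deriv^[j] g)) (fun _ _ => zero_le)
    (Finset.mem_range.mpr (Nat.lt_succ_iff.mpr hj))

lemma HRsq_eq_HR_sq (σ : ℕ) (g : ℝ → ℝ) : HRsq σ g = HR σ g ^ 2 := by
  rw [HR, ← ENNReal.rpow_natCast, ← ENNReal.rpow_mul]
  norm_num

lemma HR_le_mul_of_HRsq_le {σ : ℕ} {f g : ℝ → ℝ} {K : ℝ} (hK : 0 ≤ K)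
    (h : HRsq σ f ≤ ENNReal.ofReal (K ^ 2) * HRsq σ g) :
    HR σ f ≤ ENNReal.ofReal K * HR σ g := by
  rw [HRsq_eq_HR_sq, HRsq_eq_HR_sq, ENNReal.ofReal_pow hK, ← mul_pow] at h
  exact (ENNReal.pow_le_pow_left_iff two_ne_zero).mp h

lemma HR_two_mul (σ : ℕ) (g : ℝ → ℝ) : HR σ (fun Y => 2 * g Y) = 2 * HR σ g := by
  have h : HRsq σ (fun Y => 2 * g Y) = 2 ^ 2 * HRsq σ g := by
    simp only [HRsq, Finset.mul_sum]
    refine Finset.sum_congr rfl fun j _ => ?_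
    rw [← iteratedDeriv_eq_iterate, ← iteratedDeriv_eq_iterate, L2Rsq, L2Rsq,
      ← lintegral_const_mul' _ _ (by simp)]
    refine lintegral_congr fun Y => ?_
    rw [iteratedDeriv_const_mul_field, nnnorm_mul, ENNReal.coe_mul, mul_pow]
    simp
  rw [HR, HR, h, ENNReal.mul_rpow_of_nonneg _ _ (by norm_num), ← ENNReal.rpow_natCast,
    ← ENNReal.rpow_mul]
  norm_num

/-- One-dimensional Sobolev embedding `H¹ ⊂ L^∞`. -/
lemma ofReal_sq_le_L2Rsq {f : ℝ → ℝ} (hf : ContDiff ℝ (⊤ : ℕ∞) f) (x : ℝ) :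
    ENNReal.ofReal (f x ^ 2) ≤ 2 * (L2Rsq f + L2Rsq (deriv f)) := by
  have hfc : Continuous f := hf.continuous
  have hfc' : Continuous (deriv f) := (contDiff_deriv hf).continuous
  have hx : x ≤ x + 1 := by linarith
  set I : ℝ := ∫ y in x..x + 1, (f y ^ 2 + deriv f y ^ 2) with hI
  have hcont : Continuous fun y => f y ^ 2 + deriv f y ^ 2 := by fun_prop
  have hpt : ∀ y ∈ Set.Icc x (x + 1), f x ^ 2 ≤ f y ^ 2 + I := by
    intro y hy
    have hd : ∀ z ∈ Set.uIcc x y, HasDerivAt (fun z => f z ^ 2) (2 * f z * deriv f z) z := by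
      intro z _
      simpa using (hasDerivAt_deriv hf z).fun_pow 2
    have hftc := intervalIntegral.integral_eq_sub_of_hasDerivAt hd
      (Continuous.intervalIntegrable (by fun_prop) _ _)
    have h1 : ∫ z in x..y, -(2 * f z * deriv f z) ≤ ∫ z in x..y, (f z ^ 2 + deriv f z ^ 2) := by
      refine intervalIntegral.integral_mono_on hy.1
        (Continuous.intervalIntegrable (by fun_prop) _ _) (hcont.intervalIntegrable _ _) ?_
      intro z _
      nlinarith [sq_nonneg (f z + deriv f z)]
    have h2 : ∫ z in x..y, (f z ^ 2 + deriv f z ^ 2) ≤ I := by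
      refine intervalIntegral.integral_mono_interval le_rfl hy.1 hy.2 ?_
        (hcont.intervalIntegrable _ _)
      exact Filter.Eventually.of_forall fun z => by positivity
    rw [intervalIntegral.integral_neg, hftc] at h1
    linarith
  have havg : f x ^ 2 ≤ 2 * I := by
    have h := intervalIntegral.integral_mono_on (μ := volume) hx
      (continuous_const.intervalIntegrable (u := fun _ => f x ^ 2) _ _)
      (Continuous.intervalIntegrable (by fun_prop) _ _) hpt
    rw [intervalIntegral.integral_add (Continuous.intervalIntegrable (by fun_prop) _ _)
      (Continuous.intervalIntegrable (by fun_prop) _ _)] at h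
    simp only [intervalIntegral.integral_const, add_sub_cancel_left, one_smul] at h
    have h3 : ∫ y in x..x + 1, f y ^ 2 ≤ I := by
      refine intervalIntegral.integral_mono_on hx
        (Continuous.intervalIntegrable (by fun_prop) _ _) (hcont.intervalIntegrable _ _) ?_
      intro z _
      nlinarith [sq_nonneg (deriv f z)]
    linarith
  calc ENNReal.ofReal (f x ^ 2) ≤ ENNReal.ofReal (2 * I) := ENNReal.ofReal_le_ofReal havg
    _ = 2 * ENNReal.ofReal I := by
      rw [ENNReal.ofReal_mul zero_le_two, ENNReal.ofReal_ofNat]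
    _ ≤ 2 * (L2Rsq f + L2Rsq (deriv f)) := by
      gcongr
      rw [hI, intervalIntegral.integral_of_le hx, ofReal_integral_eq_lintegral_ofReal
        ((intervalIntegrable_iff_integrableOn_Ioc_of_le hx).mp (hcont.intervalIntegrable _ _))
        (Filter.Eventually.of_forall fun z => by positivity), L2Rsq_eq_lintegral_ofReal,
        L2Rsq_eq_lintegral_ofReal, ← lintegral_add_left (by fun_prop)]
      refine (setLIntegral_le_lintegral _ _).trans (le_of_eq (lintegral_congr fun z => ?_))
      exact ENNReal.ofReal_add (sq_nonneg _) (sq_nonneg _)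

/-- Derivatives of order below `σ` are bounded by the `H^σ` norm. -/
lemma abs_iteratedDeriv_le_of_HR_le {σ j : ℕ} (hj : j < σ) {f : ℝ → ℝ}
    (hf : ContDiff ℝ (⊤ : ℕ∞) f) {δ : ℝ} (hδ : 0 ≤ δ) (h : HR σ f ≤ ENNReal.ofReal δ) (x : ℝ) :
    |iteratedDeriv j f x| ≤ 2 * δ := by
  have hfj : ContDiff ℝ (⊤ : ℕ∞) (deriv^[j] f) := hf.iterate_deriv j
  have hsq : HRsq σ f ≤ ENNReal.ofReal (δ ^ 2) := by
    rw [HRsq_eq_HR_sq, ENNReal.ofReal_pow hδ]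
    gcongr
  have h1 := ofReal_sq_le_L2Rsq hfj x
  rw [← Function.iterate_succ_apply' deriv j f] at h1
  have h2 : ENNReal.ofReal ((deriv^[j] f x) ^ 2) ≤ ENNReal.ofReal ((2 * δ) ^ 2) := by
    calc _ ≤ _ := h1
      _ ≤ 2 * (ENNReal.ofReal (δ ^ 2) + ENNReal.ofReal (δ ^ 2)) := by
        gcongr
        · exact (L2Rsq_deriv_le_HRsq hj.le f).trans hsq
        · exact (L2Rsq_deriv_le_HRsq hj f).trans hsq
      _ = ENNReal.ofReal ((2 * δ) ^ 2) := by
        rw [← ENNReal.ofReal_add (sq_nonneg _) (sq_nonneg _), ← ENNReal.ofReal_ofNat 2,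
          ← ENNReal.ofReal_mul zero_le_two]
        ring_nf
  rw [iteratedDeriv_eq_iterate]
  exact abs_le_of_sq_le_sq ((ENNReal.ofReal_le_ofReal_iff (sq_nonneg _)).mp h2) (by positivity)

lemma lintegral_comp_rightInverse_le {V W : ℝ → ℝ} (hV : ContDiff ℝ (⊤ : ℕ∞) V)
    (hbij : Function.Bijective V) (hWV : ∀ y, W (V y) = y) (hV' : ∀ y, |deriv V y| ≤ 2)
    (φ : ℝ → ℝ≥0∞) : ∫⁻ Y, φ (W Y) ≤ 2 * ∫⁻ y, φ y := by
  have h := lintegral_image_eq_lintegral_abs_deriv_mul MeasurableSet.univ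
    (fun y _ => (hasDerivAt_deriv hV y).hasDerivWithinAt) hbij.1.injOn fun Y => φ (W Y)
  rw [Set.image_univ, hbij.2.range_eq, Measure.restrict_univ] at h
  rw [h, ← lintegral_const_mul' _ _ (by simp)]
  refine lintegral_mono fun y => ?_
  simp only [hWV]
  gcongr
  exact (ENNReal.ofReal_le_ofReal (hV' y)).trans (by simp)

/-- Composition with the inverse of a controlled diffeomorphism is bounded on `H^σ`. -/
lemma HR_comp_rightInverse_le {σ : ℕ} {D : ℝ} (hD : 1 ≤ D) {V W F : ℝ → ℝ}
    (hV : ContDiff ℝ (⊤ : ℕ∞) V) (hW : ContDiff ℝ (⊤ : ℕ∞) W) (hF : ContDiff ℝ (⊤ : ℕ∞) F)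
    (hbij : Function.Bijective V) (hWV : ∀ y, W (V y) = y) (hV' : ∀ y, |deriv V y| ≤ 2)
    (hWD : ∀ i < σ, ∀ Y, |iteratedDeriv i (deriv W) Y| ≤ D) :
    HR σ (fun Y => F (W Y)) ≤
      ENNReal.ofReal (2 * ((σ + 1) * (σ.factorial * D ^ σ))) * HR σ F := by
  set A : ℝ := σ.factorial * D ^ σ with hA
  have hA0 : 0 ≤ A := by positivity
  refine HR_le_mul_of_HRsq_le (by positivity) ?_
  have hpt : ∀ j ≤ σ, ∀ Y, iteratedDeriv j (fun Z => F (W Z)) Y ^ 2 ≤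
      (σ + 1) * A ^ 2 * ∑ i ∈ Finset.range (σ + 1), iteratedDeriv i F (W Y) ^ 2 := by
    intro j hj Y
    set S : ℝ := ∑ i ∈ Finset.range (σ + 1), |iteratedDeriv i F (W Y)| with hS
    have hS0 : 0 ≤ S := Finset.sum_nonneg fun _ _ => abs_nonneg _
    have h1 : |iteratedDeriv j (fun Z => F (W Z)) Y| ≤ A * S := by
      refine (abs_iteratedDeriv_comp_le (C := S) hD hF hW (fun i hi => hWD i (hi.trans_le hj)) Y
        fun i hi => Finset.single_le_sum (f := fun i => |iteratedDeriv i F (W Y)|)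
          (fun _ _ => abs_nonneg _) (Finset.mem_range.mpr (by omega))).trans ?_
      calc (j.factorial : ℝ) * S * D ^ j ≤ σ.factorial * S * D ^ σ := by gcongr
        _ = A * S := by rw [hA]; ring
    have h2 : S ^ 2 ≤ (σ + 1) * ∑ i ∈ Finset.range (σ + 1), iteratedDeriv i F (W Y) ^ 2 := by
      have h := sq_sum_le_card_mul_sum_sq (s := Finset.range (σ + 1))
        (f := fun i => |iteratedDeriv i F (W Y)|)
      simpa using h
    calc _ = |iteratedDeriv j (fun Z => F (W Z)) Y| ^ 2 := (sq_abs _).symm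
      _ ≤ (A * S) ^ 2 := by gcongr
      _ = A ^ 2 * S ^ 2 := mul_pow _ _ _
      _ ≤ A ^ 2 * ((σ + 1) * ∑ i ∈ Finset.range (σ + 1), iteratedDeriv i F (W Y) ^ 2) := by gcongr
      _ = _ := by ring
  have hj : ∀ j ∈ Finset.range (σ + 1), L2Rsq (deriv^[j] fun Y => F (W Y)) ≤
      ENNReal.ofReal (2 * ((σ + 1) * A ^ 2)) * HRsq σ F := by
    intro j hj
    rw [L2Rsq_eq_lintegral_ofReal, ← iteratedDeriv_eq_iterate]
    calc _ ≤ ∫⁻ Y, ENNReal.ofReal ((σ + 1) * A ^ 2) *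
          ∑ i ∈ Finset.range (σ + 1), ENNReal.ofReal (iteratedDeriv i F (W Y) ^ 2) := by
          refine lintegral_mono fun Y => ?_
          rw [← ENNReal.ofReal_sum_of_nonneg fun _ _ => sq_nonneg _,
            ← ENNReal.ofReal_mul (by positivity)]
          exact ENNReal.ofReal_le_ofReal
            (hpt j (Nat.lt_succ_iff.mp (Finset.mem_range.mp hj)) Y)
      _ ≤ 2 * ∫⁻ y, ENNReal.ofReal ((σ + 1) * A ^ 2) *
          ∑ i ∈ Finset.range (σ + 1), ENNReal.ofReal (iteratedDeriv i F y ^ 2) :=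
        lintegral_comp_rightInverse_le hV hbij hWV hV' _
      _ = _ := by
        rw [lintegral_const_mul' _ _ ENNReal.ofReal_ne_top, lintegral_finsetSum,
          ENNReal.ofReal_mul zero_le_two, ENNReal.ofReal_ofNat, mul_assoc, HRsq]
        · simp only [L2Rsq_eq_lintegral_ofReal, iteratedDeriv_eq_iterate]
        · intro i _
          have := (hF.iterate_deriv i).continuous
          rw [← iteratedDeriv_eq_iterate] at this
          exact (ENNReal.continuous_ofReal.comp (this.pow 2)).measurable
  calc HRsq σ (fun Y => F (W Y))
      ≤ ∑ _j ∈ Finset.range (σ + 1), ENNReal.ofReal (2 * ((σ + 1) * A ^ 2)) * HRsq σ F :=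
        Finset.sum_le_sum hj
    _ = ENNReal.ofReal ((σ + 1) * (2 * ((σ + 1) * A ^ 2))) * HRsq σ F := by
        rw [Finset.sum_const, Finset.card_range, nsmul_eq_mul, ← mul_assoc,
          ENNReal.ofReal_mul (p := (σ : ℝ) + 1) (by positivity)]
        congr 2
        rw [← Nat.cast_succ, ENNReal.ofReal_natCast]
    _ ≤ _ := by
        gcongr
        nlinarith [sq_nonneg ((σ + 1) * A)]

/-- The inverse of a smooth bijection of `ℝ` with positive derivative is smooth. -/
lemma contDiff_invFun {V : ℝ → ℝ} (hV : ContDiff ℝ (⊤ : ℕ∞) V) (hbij : Function.Bijective V)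
    (hpos : ∀ y, 0 < deriv V y) : ContDiff ℝ (⊤ : ℕ∞) (Function.invFun V) := by
  let e := ((strictMono_of_deriv_pos hpos).orderIsoOfSurjective V hbij.2).toHomeomorph
  have h : ContDiff ℝ (⊤ : ℕ∞) e.symm :=
    e.contDiff_symm_deriv (fun y => (hpos y).ne') (hasDerivAt_deriv hV) hV
  have he : Function.invFun V = e.symm := by
    funext Y
    apply hbij.1
    rw [Function.rightInverse_invFun hbij.2 Y]
    exact (e.apply_symm_apply Y).symm
  rwa [he]

/-- **Lemma 2.1: Sobolev bounds for the coefficients of the coordinate change.**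
If `‖V' − 1‖_{H^σ} + ‖V''‖_{H^σ} ≤ δ ≤ δ₀` and `a = V' ∘ V⁻¹`, `b = V'' ∘ V⁻¹`, then
`‖a − 1‖_{H^σ} + ‖b‖_{H^σ} ≤ C(‖V' − 1‖_{H^σ} + ‖V''‖_{H^σ}) ≤ Cδ` and
`‖∂_Y(a² − 1)‖_{H^σ} = 2‖b‖_{H^σ} ≤ C‖V''‖_{H^σ}`. -/
theorem stmt2 (σ : ℕ) (hσ : 2 ≤ σ) :
    ∃ δ₀ C : ℝ, 0 < δ₀ ∧ 0 < C ∧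
      ∀ (V : ℝ → ℝ) (δ : ℝ), ContDiff ℝ (⊤ : ℕ∞) V → 0 < δ → δ ≤ δ₀ →
        Function.Bijective V →
        HR σ (fun y => deriv V y - 1) + HR σ (deriv (deriv V)) ≤ ENNReal.ofReal δ →
        ∀ a b : ℝ → ℝ,
          (a = fun Y => deriv V (Function.invFun V Y)) →
          (b = fun Y => deriv (deriv V) (Function.invFun V Y)) →
          (HR σ (fun Y => a Y - 1) + HR σ b
              ≤ ENNReal.ofReal C *
                  (HR σ (fun y => deriv V y - 1) + HR σ (deriv (deriv V)))) ∧
          (HR σ (fun Y => a Y - 1) + HR σ b ≤ ENNReal.ofReal (C * δ)) ∧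
          (HR σ (deriv fun Y => a Y ^ 2 - 1) = 2 * HR σ b) ∧
          (2 * HR σ b ≤ ENNReal.ofReal C * HR σ (deriv (deriv V))) := by
  obtain ⟨D, hD, H⟩ := exists_bound_iteratedDeriv_rightInverse (σ - 1) 1
  set K : ℝ := 2 * ((σ + 1) * (σ.factorial * D ^ σ)) with hK
  have hK0 : 0 < K := by positivity
  refine ⟨1 / 4, 2 * K, by norm_num, by positivity, ?_⟩
  rintro V δ hV hδ hδ4 hbij hsmall a b rfl rfl
  set W := Function.invFun V
  have hV1 := contDiff_deriv hV
  have hV2 := contDiff_deriv hV1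
  have hg : ContDiff ℝ (⊤ : ℕ∞) fun y => deriv V y - 1 := hV1.sub contDiff_const
  have hclose : ∀ y, |deriv V y - 1| ≤ 1 / 2 := fun y => by
    have h := abs_iteratedDeriv_le_of_HR_le (j := 0) (by omega) hg hδ.le
      (le_self_add.trans hsmall) y
    rw [iteratedDeriv_zero] at h
    linarith
  have hlow : ∀ y, 1 / 2 ≤ deriv V y := fun y => by linarith [(abs_le.mp (hclose y)).1]
  have hup : ∀ y, |deriv V y| ≤ 2 := fun y => by
    rw [abs_le]
    constructor <;> linarith [hlow y, (abs_le.mp (hclose y)).2]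
  have hM : ∀ i < σ - 1, ∀ y, |iteratedDeriv i (deriv (deriv V)) y| ≤ 1 := fun i hi y => by
    have h := abs_iteratedDeriv_le_of_HR_le (j := i) (by omega) hV2 hδ.le
      (le_add_self.trans hsmall) y
    linarith
  have hW : ContDiff ℝ (⊤ : ℕ∞) W := contDiff_invFun hV hbij fun y => by linarith [hlow y]
  have hVW : ∀ Y, V (W Y) = Y := Function.rightInverse_invFun hbij.2
  have hWV : ∀ y, W (V y) = y := Function.leftInverse_invFun hbij.1
  have hWD := H V W hV hW hVW hlow hM
  have hcomp : ∀ F : ℝ → ℝ, ContDiff ℝ (⊤ : ℕ∞) F →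
      HR σ (fun Y => F (W Y)) ≤ ENNReal.ofReal K * HR σ F := fun F hF =>
    HR_comp_rightInverse_le hD hV hW hF hbij hWV hup fun i hi => hWD i (by omega)
  have hmain : HR σ (fun Y => deriv V (W Y) - 1) + HR σ (fun Y => deriv (deriv V) (W Y)) ≤
      ENNReal.ofReal (2 * K) *
        (HR σ (fun y => deriv V y - 1) + HR σ (deriv (deriv V))) := by
    rw [mul_add]
    refine (add_le_add (hcomp _ hg) (hcomp _ hV2)).trans ?_
    gcongr <;> linarith
  refine ⟨hmain, hmain.trans ?_, ?_, ?_⟩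
  · rw [ENNReal.ofReal_mul (p := 2 * K) (by positivity)]
    gcongr
  · rw [← HR_two_mul]
    congr 1
    funext Y
    have h := (((hasDerivAt_deriv hV1 (W Y)).comp Y (hasDerivAt_deriv hW Y)).pow 2).sub_const 1
    refine h.deriv.trans ?_
    simp only [Function.comp_apply]
    push_cast
    linear_combination
      2 * deriv (deriv V) (W Y) * deriv_mul_deriv_rightInverse hV hW hVW Y
  · rw [ENNReal.ofReal_mul zero_le_two, ENNReal.ofReal_ofNat, mul_assoc]
    gcongr
    exact hcomp _ hV2
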